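/- Let d be a positive odd squarefree integer. Suppose that (i) the narrow class group of ℚ(√(2d)) has no elements of order 4, and (ii) (−2/p) = 1 for all odd primes p dividing d. Then the equation x² − 2d·y² = −2 has a solution in integers x and y. -/

import Mathlib

open NumberField IntermediateField
open scoped nonZeroDivisors

/-- The subgroup of invertible fractional ideals generated by principal fractional ideals
with a totally positive generator. -/
def narrowPrincipals (F : Type*) [Field F] :
    Subgroup (FractionalIdeal (𝓞 F)⁰ F)ˣ :=
  Subgroup.closure {I | ∃ x : F, (∀ φ : F →+* ℝ, 0 < φ x) ∧
    ((I : FractionalIdeal (𝓞 F)⁰ F) : Submodule (𝓞 F) F) = Submodule.span (𝓞 F) {x}}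

/-- The narrow class group: nonzero fractional ideals modulo principal fractional ideals
generated by totally positive elements. -/
abbrev NarrowClassGroup (F : Type*) [Field F] :=
  (FractionalIdeal (𝓞 F)⁰ F)ˣ ⧸ narrowPrincipals F

/-- `ℚ(√n)` as a subfield of `ℂ`. -/
noncomputable def quadField (n : ℕ) : IntermediateField ℚ ℂ := ℚ⟮(Real.sqrt n : ℂ)⟯


theorem thue_prime (p : ℕ) (hp : p.Prime) (hodd : Odd p) (h : jacobiSym (-2) p = 1) :
    ∃ a b : ℤ, (p : ℤ) = a ^ 2 + 2 * b ^ 2 := by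
  have := Fact.mk hp
  have hsq : IsSquare ((-2 : ℤ) : ZMod p) := by
    rw [← jacobiSym.legendreSym.to_jacobiSym] at h
    have h0 : ((-2 : ℤ) : ZMod p) ≠ 0 := by
      intro h0
      rw [(legendreSym.eq_zero_iff p (-2)).2 h0] at h
      exact zero_ne_one h
    exact (legendreSym.eq_one_iff p h0).1 h
  obtain ⟨r, hr⟩ := hsq
  set s := Nat.sqrt p with hs
  have hs1 : p < (s + 1) * (s + 1) := Nat.lt_succ_sqrt p
  have hs2 : s * s ≤ p := Nat.sqrt_le p
  have hs3 : s * s < p := by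
    refine lt_of_le_of_ne hs2 fun he => ?_
    rw [← he] at hp
    obtain h1 | h1 := Nat.prime_mul_iff.1 hp <;> exact h1.1.ne_one h1.2
  let S : Finset (ℕ × ℕ) := Finset.range (s + 1) ×ˢ Finset.range (s + 1)
  have hcard : (Finset.univ : Finset (ZMod p)).card < S.card := by
    simp [S, ZMod.card, hs1]
  obtain ⟨u, hu, v, hv, huv, he⟩ := Finset.exists_ne_map_eq_of_card_lt_of_maps_to hcard
    (f := fun u : ℕ × ℕ => (u.1 : ZMod p) - r * u.2) (fun _ _ => Finset.mem_coe.2 (Finset.mem_univ _))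
  simp only [S, Finset.mem_product, Finset.mem_range] at hu hv
  set x : ℤ := (u.1 : ℤ) - v.1 with hx
  set y : ℤ := (u.2 : ℤ) - v.2 with hy
  have hne : x ≠ 0 ∨ y ≠ 0 := by
    by_contra! hc
    apply huv
    ext <;> omega
  have hdvd : (p : ℤ) ∣ x ^ 2 + 2 * y ^ 2 := by
    rw [← ZMod.intCast_zmod_eq_zero_iff_dvd]
    have h1 : (x : ZMod p) = r * y := by
      push_cast [hx, hy]
      linear_combination he
    push_cast
    rw [h1]
    push_cast at hr
    linear_combination (-(y : ZMod p) ^ 2) * hr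
  have hs4 : (s : ℤ) * s < p := by exact_mod_cast hs3
  have hx2 : x ^ 2 < p := by nlinarith [show x ≤ s by omega, show -x ≤ s by omega]
  have hy2 : y ^ 2 < p := by nlinarith [show y ≤ s by omega, show -y ≤ s by omega]
  have hpos : 0 < x ^ 2 + 2 * y ^ 2 := by
    rcases hne with h | h <;> positivity
  obtain ⟨k, hk⟩ := hdvd
  have hp0 : (0 : ℤ) < p := by exact_mod_cast hp.pos
  have hk0 : 0 < k := by
    by_contra! hc
    nlinarith
  have hk3 : k < 3 := by
    by_contra! hc
    nlinarith
  interval_cases k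
  · exact ⟨x, y, by linarith⟩
  · have : Even x := by
      have : Even (x ^ 2) := ⟨p - y ^ 2, by linarith⟩
      rwa [Int.even_pow' two_ne_zero] at this
    obtain ⟨t, ht⟩ := this
    refine ⟨y, t, ?_⟩
    rw [ht] at hk
    nlinarith

theorem repr_d (d : ℕ) (hpos : d ≠ 0) (hodd : Odd d)
    (hleg : ∀ p : ℕ, p.Prime → Odd p → p ∣ d → jacobiSym (-2) p = 1) :
    ∃ a b : ℤ, (d : ℤ) = a ^ 2 + 2 * b ^ 2 := by
  induction d using induction_on_primes with
  | zero => exact absurd rfl hpos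
  | one => exact ⟨1, 0, by norm_num⟩
  | prime_mul p m hp ih =>
    rw [Nat.odd_mul] at hodd
    obtain ⟨a, b, hab⟩ := ih (right_ne_zero_of_mul hpos) hodd.2
      (fun q h1 h2 h3 => hleg q h1 h2 (h3.mul_left p))
    obtain ⟨e, f, hef⟩ := thue_prime p hp hodd.1 (hleg p hp hodd.1 (dvd_mul_right _ _))
    refine ⟨a * e - 2 * b * f, a * f + b * e, ?_⟩
    push_cast
    rw [hab, hef]; ring

theorem ideal_sq1 {R : Type*} [CommRing R] (z w : ℤ) (hz : IsCoprime z (4 * w)) (β : R)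
    (h : β ^ 2 = 4 * w * β + 2 * (z : R) ^ 2) :
    Ideal.span {(z : R), β} * Ideal.span {(z : R), β} = Ideal.span {(z : R) ^ 2, β} := by
  rw [Ideal.span_pair_mul_span_pair]
  apply le_antisymm
  · rw [Ideal.span_le]
    rintro x (rfl | rfl | rfl | rfl) <;> rw [SetLike.mem_coe, Ideal.mem_span_pair]
    · exact ⟨1, 0, by ring⟩
    · exact ⟨0, z, by ring⟩
    · exact ⟨0, z, by ring⟩
    · exact ⟨0, β, by ring⟩
  · obtain ⟨a, b, hab⟩ := hz
    have hab' : (a : R) * z + b * (4 * w) = 1 := by exact_mod_cast congrArg (Int.cast : ℤ → R) hab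
    rw [Ideal.span_le]
    set I := Ideal.span {(z : R) * z, z * β, β * z, β * β} with hI
    have h1 : (z : R) * z ∈ I := Ideal.subset_span (by simp)
    have h2 : (z : R) * β ∈ I := Ideal.subset_span (by simp)
    have h3 : β * β ∈ I := Ideal.subset_span (by simp)
    rintro x (rfl | rfl)
    · rw [pow_two]; exact h1
    · have : x = a * (z * x) + b * (x * x) + (- 2 * b) * ((z : R) * z) := by
        linear_combination (-x) * hab' - b * h
      rw [this]
      exact I.add_mem (I.add_mem (I.mul_mem_left _ h2) (I.mul_mem_left _ h3)) (I.mul_mem_left _ h1)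

theorem ideal_sq2 {R : Type*} [CommRing R] (z w : ℤ) (hz : Odd z) (β : R)
    (h : β ^ 2 = 4 * w * β + 2 * (z : R) ^ 2) :
    Ideal.span {(z : R) ^ 2, β} * Ideal.span {(z : R) ^ 2, β} =
      Ideal.span {(z : R) ^ 2 + 2 * w * β} := by
  rw [Ideal.span_pair_mul_span_pair]
  apply le_antisymm
  · rw [Ideal.span_le]
    rintro x (rfl | rfl | rfl | rfl) <;> rw [SetLike.mem_coe, Ideal.mem_span_singleton']
    · exact ⟨z ^ 2 + 2 * w * (4 * w - β), by linear_combination (-4 * (w : R) ^ 2) * h⟩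
    · exact ⟨-(4 * w - β), by linear_combination (2 * (w : R)) * h⟩
    · exact ⟨-(4 * w - β), by linear_combination (2 * (w : R)) * h⟩
    · exact ⟨2, by linear_combination (-1 : R) * h⟩
  · obtain ⟨k, hk⟩ := hz.pow (n := 2)
    have hk' : (z : R) ^ 2 = 2 * k + 1 := by exact_mod_cast congrArg (Int.cast : ℤ → R) hk
    rw [Ideal.span_le]
    set I := Ideal.span {(z : R) ^ 2 * z ^ 2, z ^ 2 * β, β * z ^ 2, β * β} with hI
    have h1 : (z : R) ^ 2 * z ^ 2 ∈ I := Ideal.subset_span (by simp)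
    have h2 : (z : R) ^ 2 * β ∈ I := Ideal.subset_span (by simp)
    have h3 : β * β ∈ I := Ideal.subset_span (by simp)
    rintro x rfl
    have : (z : R) ^ 2 + 2 * w * β =
        1 * ((z : R) ^ 2 * z ^ 2) + 2 * w * (z ^ 2 * β) + (-k) * (β * β) := by
      linear_combination k * h - (z ^ 2 + 2 * w * β) * hk'
    rw [this]
    exact I.add_mem (I.add_mem (I.mul_mem_left _ h1) (I.mul_mem_left _ h2)) (I.mul_mem_left _ h3)

theorem int_of_sq (n : ℤ) (hn : Squarefree n) (B : ℚ) (M : ℤ) (h : n * B ^ 2 = M) :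
    ∃ b : ℤ, B = b := by
  have hd : (B.den : ℚ) ≠ 0 := by exact_mod_cast B.den_nz
  have h1 : n * B.num ^ 2 = M * (B.den : ℤ) ^ 2 := by
    have : (n : ℚ) * B.num ^ 2 = M * (B.den : ℚ) ^ 2 := by
      rw [← h]
      nth_rewrite 2 [← Rat.num_div_den B]
      field_simp
    exact_mod_cast this
  have hc : IsCoprime (B.den : ℤ) B.num := by
    have := B.reduced
    rw [Int.isCoprime_iff_gcd_eq_one]
    rw [Int.gcd_comm]
    simpa [Int.gcd] using this
  have h2 : (B.den : ℤ) ^ 2 ∣ n :=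
    (hc.pow (m := 2) (n := 2)).dvd_of_dvd_mul_right ⟨M, by linarith⟩
  have h3 := hn _ (by rwa [pow_two] at h2)
  have h4 : B.den = 1 := by
    rw [Int.isUnit_iff] at h3
    omega
  exact ⟨B.num, ((Rat.den_eq_one_iff B).1 h4).symm⟩

theorem rat_of_integral (q : ℚ) (h : IsIntegral ℤ (q : ℝ)) : ∃ m : ℤ, q = m := by
  have : IsIntegral ℤ q := by
    rw [← isIntegral_algebraMap_iff (algebraMap ℚ ℝ).injective]
    simpa using h
  obtain ⟨m, hm⟩ := IsIntegrallyClosed.isIntegral_iff.1 this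
  exact ⟨m, by simpa using hm.symm⟩

theorem coords (d : ℕ) (hodd : Odd d) (hsf : Squarefree d) (a b : ℚ) (s : ℝ)
    (hs : s ^ 2 = 2 * d) (h1 : IsIntegral ℤ ((a : ℝ) + b * s)) (h2 : IsIntegral ℤ ((a : ℝ) - b * s)) :
    ∃ x y : ℤ, a = x ∧ b = y := by
  obtain ⟨A, hA⟩ := rat_of_integral (2 * a) (by
    have := h1.add h2
    push_cast
    have e : (a : ℝ) + b * s + (a - b * s) = 2 * a := by ring
    rwa [e] at this)
  obtain ⟨M, hM⟩ := rat_of_integral (a ^ 2 - 2 * d * b ^ 2) (by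
    have := h1.mul h2
    push_cast
    have e : ((a : ℝ) + b * s) * (a - b * s) = a ^ 2 - 2 * d * b ^ 2 := by
      linear_combination (-(b : ℝ) ^ 2) * hs
    rwa [e] at this)
  have hsf2 : Squarefree ((2 * d : ℕ) : ℤ) := by
    rw [Int.squarefree_natCast, Nat.squarefree_mul (Nat.coprime_two_left.2 hodd)]
    exact ⟨Nat.prime_two.squarefree, hsf⟩
  obtain ⟨B, hB⟩ := int_of_sq _ hsf2 (2 * b) (A ^ 2 - 4 * M) (by
    push_cast
    rw [← hA, ← hM]; ring)
  have h3 : A ^ 2 - 2 * d * B ^ 2 = 4 * M := by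
    have : (A : ℚ) ^ 2 - 2 * d * B ^ 2 = 4 * M := by rw [← hA, ← hB, ← hM]; ring
    exact_mod_cast this
  have hAe : Even A := by
    have : Even (A ^ 2) := ⟨d * B ^ 2 + 2 * M, by linarith⟩
    rwa [Int.even_pow' two_ne_zero] at this
  obtain ⟨x, hx⟩ := hAe
  have hBe : Even B := by
    have : Even ((d : ℤ) * B ^ 2) := ⟨x ^ 2 - M, by rw [hx] at h3; linarith⟩
    rw [Int.even_mul, Int.even_pow' two_ne_zero] at this
    rcases this with h | h
    · rw [Int.even_coe_nat] at h
      exact absurd h (Nat.not_even_iff_odd.2 hodd)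
    · exact h
  obtain ⟨y, hy⟩ := hBe
  refine ⟨x, y, ?_, ?_⟩
  · rw [hx] at hA; push_cast at hA; linarith
  · rw [hy] at hB; push_cast at hB; linarith

theorem narrow_mem (F : Type*) [Field F] [NumberField F] (I : (FractionalIdeal (𝓞 F)⁰ F)ˣ)
    (h : I ∈ narrowPrincipals F) :
    ∃ x : F, (∀ φ : F →+* ℝ, 0 < φ x) ∧
      (I : FractionalIdeal (𝓞 F)⁰ F) = FractionalIdeal.spanSingleton _ x := by
  induction h using Subgroup.closure_induction with
  | mem I hI =>
    obtain ⟨x, hx, hI⟩ := hI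
    refine ⟨x, hx, FractionalIdeal.coeToSubmodule_injective ?_⟩
    simp only [FractionalIdeal.coe_spanSingleton]
    exact hI
  | one => exact ⟨1, by simp, by simp⟩
  | mul I J _ _ hI hJ =>
    obtain ⟨x, hx, hI⟩ := hI
    obtain ⟨y, hy, hJ⟩ := hJ
    refine ⟨x * y, fun φ => ?_, ?_⟩
    · rw [map_mul]; exact mul_pos (hx φ) (hy φ)
    · rw [Units.val_mul, hI, hJ, FractionalIdeal.spanSingleton_mul_spanSingleton]
  | inv I _ hI =>
    obtain ⟨x, hx, hI⟩ := hI
    refine ⟨x⁻¹, fun φ => ?_, ?_⟩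
    · rw [map_inv₀]; exact inv_pos.2 (hx φ)
    · rw [Units.val_inv_eq_inv_val, hI, FractionalIdeal.spanSingleton_inv]

theorem core (d : ℕ) (hpos : 0 < d) (hodd : Odd d) (hsf : Squarefree d)
    (F : Type*) [Field F] [NumberField F] (θ : F) (hθ : θ ^ 2 = 2 * d)
    (hF : ∀ x : F, ∃ a b : ℚ, x = a + b * θ) (s : ℝ) (hs : s ^ 2 = 2 * d)
    (φ ψ : F →+* ℝ) (hφ : φ θ = s) (hψ : ψ θ = -s)
    (h4 : ∀ g : NarrowClassGroup F, orderOf g ≠ 4)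
    (hleg : ∀ p : ℕ, p.Prime → Odd p → p ∣ d → jacobiSym (-2) p = 1) :
    ∃ x y : ℤ, x ^ 2 - 2 * (d : ℤ) * y ^ 2 = -2 := by
  obtain ⟨z, w, hzw⟩ := repr_d d hpos.ne' hodd hleg
  have hzodd : Odd z := by
    have h1 : Odd (d : ℤ) := by exact_mod_cast hodd
    rw [hzw, Int.odd_add] at h1
    have := h1.2 (even_two_mul _)
    exact (Int.odd_pow' two_ne_zero).1 this
  have hz0 : z ≠ 0 := by rintro rfl; simp at hzodd
  have hcop : IsCoprime z (4 * w) := by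
    have h1 : IsCoprime z w := by
      rw [Int.isCoprime_iff_gcd_eq_one]
      have hd : ((Int.gcd z w : ℤ)) * (Int.gcd z w : ℤ) ∣ (d : ℤ) := by
        rw [hzw, ← pow_two]
        exact dvd_add (pow_dvd_pow_of_dvd (Int.gcd_dvd_left ..) 2)
          ((pow_dvd_pow_of_dvd (Int.gcd_dvd_right ..) 2).mul_left _)
      have := hsf _ (by exact_mod_cast hd)
      simpa using this
    have h2 : IsCoprime z 2 := by
      obtain ⟨k, hk⟩ := hzodd
      exact ⟨1, -k, by linarith⟩
    have h3 : IsCoprime z (2 * 2 * w) := (h2.mul_right h2).mul_right h1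
    simpa using h3
  -- integral points have integer norm
  have hint : ∀ u : 𝓞 F, ∃ x y : ℤ, φ u * ψ u = x ^ 2 - 2 * d * y ^ 2 := by
    intro u
    obtain ⟨a, b, hab⟩ := hF u
    have e1 : φ u = a + b * s := by rw [hab]; simp [hφ]
    have e2 : ψ u = a - b * s := by rw [hab]; simp [hψ]; ring
    have i1 : IsIntegral ℤ (φ u) := map_isIntegral_int φ u.isIntegral_coe
    have i2 : IsIntegral ℤ (ψ u) := map_isIntegral_int ψ u.isIntegral_coe
    rw [e1] at i1
    rw [e2] at i2
    obtain ⟨x, y, rfl, rfl⟩ := coords d hodd hsf a b s hs i1 i2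
    refine ⟨x, y, ?_⟩
    rw [e1, e2]
    push_cast
    linear_combination (-(y : ℝ) ^ 2) * hs
  -- the elements
  have hθint : IsIntegral ℤ θ := by
    apply IsIntegral.of_pow (n := 2) two_pos
    rw [hθ]
    exact_mod_cast (isIntegral_algebraMap (R := ℤ) (A := F) (x := ((2 * d : ℕ) : ℤ)))
  let θ' : 𝓞 F := ⟨θ, hθint⟩
  let β : 𝓞 F := 2 * (w : 𝓞 F) + θ'
  have hβF : (β : F) = 2 * w + θ := by
    change algebraMap (𝓞 F) F (2 * (w : 𝓞 F) + θ') = 2 * w + θ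
    rw [map_add, map_mul, map_intCast, map_ofNat]
    rfl
  have hβ : β ^ 2 = 4 * w * β + 2 * (z : 𝓞 F) ^ 2 := by
    apply RingOfIntegers.coe_injective
    have hd' : (d : F) = z ^ 2 + 2 * w ^ 2 := by exact_mod_cast congrArg (Int.cast : ℤ → F) hzw
    push_cast [hβF]
    simp only [map_add, map_mul, map_pow, hβF, map_intCast, map_ofNat]
    linear_combination hθ + 2 * hd'
  have I1 := ideal_sq1 z w hcop β hβ
  have I2 := ideal_sq2 z w hzodd β hβ
  set δ : 𝓞 F := (z : 𝓞 F) ^ 2 + 2 * w * β with hδ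
  have h2δ : 2 * (δ : F) = (β : F) ^ 2 := by
    have : 2 * δ = β ^ 2 := by rw [hβ, hδ]; ring
    have h := congrArg (algebraMap (𝓞 F) F) this
    rwa [map_mul, map_pow, map_ofNat] at h
  have hdR : (d : ℝ) = z ^ 2 + 2 * w ^ 2 := by exact_mod_cast congrArg (Int.cast : ℤ → ℝ) hzw
  have hNβ : φ β * ψ β = -2 * z ^ 2 := by
    rw [hβF]
    simp only [map_add, map_mul, map_intCast, map_ofNat, hφ, hψ]
    linear_combination -hs - 2 * hdR
  have hzR : (z : ℝ) ≠ 0 := by exact_mod_cast hz0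
  have hβ0 : (β : F) ≠ 0 := by
    intro h
    rw [h] at hNβ
    simp [hzR] at hNβ
  have hNδ : (φ δ * ψ δ) = z ^ 4 := by
    have e1 : 2 * φ δ = φ β ^ 2 := by simpa only [map_mul, map_pow, map_ofNat] using congrArg φ h2δ
    have e2 : 2 * ψ δ = ψ β ^ 2 := by simpa only [map_mul, map_pow, map_ofNat] using congrArg ψ h2δ
    have : 4 * (φ δ * ψ δ) = (φ β * ψ β) ^ 2 := by
      rw [mul_pow, ← e1, ← e2]; ring
    rw [hNβ] at this
    linarith
  have hδ0 : (δ : F) ≠ 0 := by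
    intro h
    rw [h] at hNδ
    rw [map_zero, zero_mul] at hNδ
    exact pow_ne_zero 4 hzR hNδ.symm
  have hδpos : ∀ χ : F →+* ℝ, 0 < χ δ := by
    intro χ
    have e1 : 2 * χ δ = χ β ^ 2 := by simpa only [map_mul, map_pow, map_ofNat] using congrArg χ h2δ
    have : 0 < χ β ^ 2 := by
      have : χ β ≠ 0 := (map_ne_zero χ).2 hβ0
      positivity
    linarith
  -- the ideal class
  set J : FractionalIdeal (𝓞 F)⁰ F := ((Ideal.span {(z : 𝓞 F), β} : Ideal (𝓞 F)) :
    FractionalIdeal (𝓞 F)⁰ F) with hJ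
  have hJ2 : J * J = ((Ideal.span {(z : 𝓞 F) ^ 2, β} : Ideal (𝓞 F)) :
    FractionalIdeal (𝓞 F)⁰ F) := by rw [hJ, ← FractionalIdeal.coeIdeal_mul, I1]
  have hJ4 : (J * J) * (J * J) = FractionalIdeal.spanSingleton (𝓞 F)⁰ (δ : F) := by
    rw [hJ2, ← FractionalIdeal.coeIdeal_mul, I2, FractionalIdeal.coeIdeal_span_singleton]
  have hJ0 : J ≠ 0 := by
    intro h
    rw [h] at hJ4
    simp only [mul_zero] at hJ4
    exact hδ0 (FractionalIdeal.spanSingleton_eq_zero_iff.1 hJ4.symm)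
  let C : (FractionalIdeal (𝓞 F)⁰ F)ˣ := Units.mk0 J hJ0
  have hC4 : C ^ 4 ∈ narrowPrincipals F := by
    apply Subgroup.subset_closure
    refine ⟨δ, hδpos, ?_⟩
    rw [← FractionalIdeal.coe_spanSingleton (𝓞 F)⁰, ← hJ4]
    congr 1
    simp [C]; ring
  have hC2 : C ^ 2 ∈ narrowPrincipals F := by
    by_contra hC
    apply h4 (QuotientGroup.mk C)
    have := orderOf_eq_prime_pow (x := (QuotientGroup.mk C : NarrowClassGroup F)) (p := 2) (n := 1)
      (by rw [← QuotientGroup.mk_pow, QuotientGroup.eq_one_iff]; simpa using hC)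
      (by rw [← QuotientGroup.mk_pow, QuotientGroup.eq_one_iff]; simpa using hC4)
    simpa using this
  obtain ⟨ε, hε, hCε⟩ := narrow_mem F _ hC2
  have hJε : J * J = FractionalIdeal.spanSingleton (𝓞 F)⁰ ε := by
    rw [← hCε]; simp [C, pow_two]
  have hβmem : (β : F) ∈ FractionalIdeal.spanSingleton (𝓞 F)⁰ ε := by
    rw [← hJε, hJ2]
    exact FractionalIdeal.mem_coeIdeal_of_mem _ (Ideal.subset_span (by simp))
  obtain ⟨α, hα⟩ := (FractionalIdeal.mem_spanSingleton _).1 hβmem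
  have hε2 : FractionalIdeal.spanSingleton (𝓞 F)⁰ (ε * ε) =
      FractionalIdeal.spanSingleton (𝓞 F)⁰ (δ : F) := by
    rw [← FractionalIdeal.spanSingleton_mul_spanSingleton, ← hJε, hJ4]
  obtain ⟨u, hu⟩ := (FractionalIdeal.mem_spanSingleton _).1
    (hε2 ▸ FractionalIdeal.mem_spanSingleton_self (𝓞 F)⁰ (ε * ε))
  obtain ⟨v, hv⟩ := (FractionalIdeal.mem_spanSingleton _).1
    (hε2.symm ▸ FractionalIdeal.mem_spanSingleton_self (𝓞 F)⁰ (δ : F))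
  rw [Algebra.smul_def] at hα hu hv
  have huv : (v : F) * u = 1 := by
    apply mul_right_cancel₀ hδ0
    rw [one_mul, mul_assoc]
    exact (congrArg _ hu).trans hv
  obtain ⟨x, y, hxy⟩ := hint α
  obtain ⟨x1, y1, hu1⟩ := hint u
  obtain ⟨x2, y2, hv1⟩ := hint v
  have hNuv : (φ v * ψ v) * (φ u * ψ u) = 1 := by
    have e1 := congrArg φ huv
    have e2 := congrArg ψ huv
    rw [map_mul, map_one] at e1 e2
    linear_combination (ψ v * ψ u) * e1 + e2
  have hNu : (φ ε * ψ ε) ^ 2 = (φ u * ψ u) * z ^ 4 := by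
    have e1 := congrArg φ hu
    have e2 := congrArg ψ hu
    rw [map_mul, map_mul] at e1 e2
    rw [← hNδ]
    linear_combination (-(ψ ε * ψ ε)) * e1 - φ u * φ δ * e2
  have hNα : (φ α * ψ α) * (φ ε * ψ ε) = -2 * z ^ 2 := by
    rw [← hNβ, ← hα, map_mul, map_mul]; ring
  have hεpos : 0 < φ ε * ψ ε := mul_pos (hε φ) (hε ψ)
  have hupos : 0 < φ u * ψ u := by
    by_contra! hc
    have : 0 < (z : ℝ) ^ 4 := by positivity
    nlinarith
  have hu_one : φ u * ψ u = 1 := by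
    rw [hu1, hv1] at hNuv
    rw [hu1] at hupos ⊢
    norm_cast at hNuv hupos ⊢
    rcases Int.eq_one_or_neg_one_of_mul_eq_one' hNuv with h | h
    · exact h.2
    · omega
  rw [hu_one, one_mul] at hNu
  have hεz : φ ε * ψ ε = z ^ 2 := by
    have : 0 < (z : ℝ) ^ 2 := by positivity
    rw [← sq_eq_sq₀ hεpos.le this.le]
    linarith
  rw [hεz] at hNα
  have hfin : φ α * ψ α = -2 := mul_right_cancel₀ (pow_ne_zero 2 hzR) hNα
  refine ⟨x, y, ?_⟩
  rw [hxy] at hfin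
  exact_mod_cast hfin

theorem not_sq (d : ℕ) (hodd : Odd d) : ¬ IsSquare (2 * d) := by
  rintro ⟨r, hr⟩
  have : Even r := by
    have : Even (r * r) := ⟨d, by omega⟩
    simpa [Nat.even_mul] using this
  obtain ⟨t, rfl⟩ := this
  have h1 : d = 2 * (t * t) := by nlinarith
  exact (Nat.not_even_iff_odd.2 hodd) (h1 ▸ even_two_mul _)

theorem minpoly_sqrt (d : ℕ) (hodd : Odd d) :
    minpoly ℚ ((Real.sqrt (2 * d : ℕ) : ℝ) : ℂ) = Polynomial.X ^ 2 - Polynomial.C ((2 * d : ℕ) : ℚ) := by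
  symm
  have hs : (Real.sqrt (2 * d : ℕ)) ^ 2 = (2 * d : ℕ) := Real.sq_sqrt (by positivity)
  apply minpoly.eq_of_irreducible_of_monic
  · apply X_pow_sub_C_irreducible_of_prime Nat.prime_two
    intro b hb
    apply not_sq d hodd
    rw [← Rat.isSquare_natCast_iff]
    exact ⟨b, by rw [← hb]; ring⟩
  · simp only [map_sub, map_pow, Polynomial.aeval_X, Polynomial.aeval_C]
    rw [← Complex.ofReal_pow, hs]
    simp
  · exact Polynomial.monic_X_pow_sub_C _ two_ne_zero

/-- if `d` is a positive odd squarefree integer such that the narrow class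
group of `ℚ(√(2d))` has no element of order 4 and `(-2/p) = 1` for all odd primes `p ∣ d`,
then `x² - 2d·y² = -2` has an integer solution. -/
theorem stmt4 (d : ℕ) (hpos : 0 < d) (hodd : Odd d) (hsf : Squarefree d)
    (h4 : ∀ g : NarrowClassGroup (quadField (2 * d)), orderOf g ≠ 4)
    (hleg : ∀ p : ℕ, p.Prime → Odd p → p ∣ d → jacobiSym (-2) p = 1) :
    ∃ x y : ℤ, x ^ 2 - 2 * (d : ℤ) * y ^ 2 = -2 := by
  have hs : (Real.sqrt (2 * d : ℕ)) ^ 2 = 2 * d := by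
    rw [Real.sq_sqrt (by positivity)]; push_cast; ring
  have hmp := minpoly_sqrt d hodd
  have hi : IsIntegral ℚ ((Real.sqrt (2 * d : ℕ) : ℝ) : ℂ) := by
    apply not_not.1
    intro h
    have h0 := minpoly.eq_zero h
    rw [hmp] at h0
    exact (Polynomial.monic_X_pow_sub_C ((2 * d : ℕ) : ℚ) two_ne_zero).ne_zero h0
  let pb : PowerBasis ℚ (quadField (2 * d)) := adjoin.powerBasis hi
  have : FiniteDimensional ℚ (quadField (2 * d)) := pb.finite
  have : NumberField (quadField (2 * d)) := { }
  have hmg : minpoly ℚ pb.gen = Polynomial.X ^ 2 - Polynomial.C ((2 * d : ℕ) : ℚ) := by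
    rw [← hmp]
    exact minpoly_gen ℚ _
  have hgen : pb.gen ^ 2 = 2 * d := by
    have := minpoly.aeval ℚ pb.gen
    rw [hmg] at this
    simp only [map_sub, map_pow, Polynomial.aeval_X, Polynomial.aeval_C, map_natCast] at this
    push_cast at this
    linear_combination this
  have hroot : ∀ t : ℝ, t ^ 2 = 2 * d → Polynomial.aeval t (minpoly ℚ pb.gen) = 0 := by
    intro t ht
    rw [hmg]
    simp [ht]
  have hdim : pb.dim = 2 := by
    rw [← pb.natDegree_minpoly, hmg]
    exact Polynomial.natDegree_X_pow_sub_C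
  refine core d hpos hodd hsf (quadField (2 * d)) pb.gen hgen ?_ _ hs
    (pb.lift _ (hroot _ hs) : quadField (2 * d) →ₐ[ℚ] ℝ).toRingHom
    (pb.lift (-Real.sqrt (2 * d : ℕ)) (hroot _ (by rw [neg_sq, hs])) :
      quadField (2 * d) →ₐ[ℚ] ℝ).toRingHom
    (pb.lift_gen _ _) (pb.lift_gen _ _) h4 hleg
  intro x
  obtain ⟨f, hf, hx⟩ := pb.exists_eq_aeval x
  rw [hdim] at hf
  obtain ⟨b, a, rfl⟩ := Polynomial.exists_eq_X_add_C_of_natDegree_le_one (Nat.lt_succ_iff.1 hf)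
  refine ⟨a, b, ?_⟩
  rw [hx]
  simp [add_comm]
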